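/- arXiv:1905.00053 — 3 statements merged into one kernel-verified Lean document; each statement's English description precedes it below -/
import Mathlib

section
/- Let K be an algebraically closed field equipped with an absolute value |·| : K → ℝ. Let n ≥ 1, let H be a finite subgroup of the group GL_n(K) of invertible n × n matrices over K, and let A ∈ GL_n(K) be an element normalizing H, i.e. A h A⁻¹ ∈ H for all h ∈ H. Then for every h ∈ H, the multiset obtained by applying |·| to the multiset of roots (counted with multiplicity) of the characteristic polynomial of the matrix A·h is equal to the corresponding multiset for the matrix A. (Since K is algebraically closed, each characteristic polynomial has exactly n roots with multiplicity.) -/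
open Polynomial in
/-- The determinant of a polynomial in a matrix is the product of the values of the polynomial at
the eigenvalues. -/
theorem Matrix.det_aeval_eq_prod_roots_charpoly {K ι : Type*} [Field K] [IsAlgClosed K]
    [Fintype ι] [DecidableEq ι] (M : Matrix ι ι K) (q : K[X]) :
    (aeval M q).det = (M.charpoly.roots.map fun a => q.eval a).prod := by
  have hlin (a : K) : (aeval M (C a - X)).det =
      (M.charpoly.roots.map fun b => (C a - X : K[X]).eval b).prod := by
    have h := (IsAlgClosed.splits M.charpoly).eval_eq_prod_roots_of_monic M.charpoly_monic a
    rw [Matrix.eval_charpoly] at h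
    simpa [Matrix.algebraMap_eq_diagonal, Matrix.scalar_apply, Pi.algebraMap_def] using h
  have hconst (c : K) : (aeval M (C c)).det =
      (M.charpoly.roots.map fun b => (C c : K[X]).eval b).prod := by
    simp [Matrix.algebraMap_eq_diagonal,
      ← (IsAlgClosed.splits M.charpoly).natDegree_eq_card_roots]
  have hmul (p r : K[X])
      (hp : (aeval M p).det = (M.charpoly.roots.map fun a => p.eval a).prod)
      (hr : (aeval M r).det = (M.charpoly.roots.map fun a => r.eval a).prod) :
      (aeval M (p * r)).det = (M.charpoly.roots.map fun a => (p * r).eval a).prod := by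
    simp [hp, hr, Matrix.det_mul, Multiset.prod_map_mul]
  rw [(IsAlgClosed.splits q).eq_prod_roots]
  refine hmul _ _ (hconst _) ?_
  induction q.roots using Multiset.induction with
  | empty => simp
  | cons a s ih =>
    rw [Multiset.map_cons, Multiset.prod_cons]
    refine hmul _ _ ?_ ih
    have := hmul _ _ (hconst (-1)) (hlin a)
    rwa [show (C (-1) * (C a - X) : K[X]) = X - C a by simp] at this

/-- The eigenvalues of `M ^ k`, with multiplicity, are the `k`-th powers of those of `M`. -/
theorem Matrix.roots_charpoly_pow {K ι : Type*} [Field K] [IsAlgClosed K]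
    [Fintype ι] [DecidableEq ι] (M : Matrix ι ι K) (k : ℕ) :
    (M ^ k).charpoly.roots = M.charpoly.roots.map (· ^ k) := by
  have : Infinite K := IsAlgClosed.instInfinite
  suffices h : (M ^ k).charpoly =
      ((M.charpoly.roots.map (· ^ k)).map fun a => Polynomial.X - Polynomial.C a).prod by
    rw [h, Polynomial.roots_multiset_prod_X_sub_C]
  refine Polynomial.funext fun t => ?_
  have h := M.det_aeval_eq_prod_roots_charpoly (Polynomial.C t - Polynomial.X ^ k)
  simp only [map_sub, map_pow, Polynomial.aeval_C, Polynomial.aeval_X, Polynomial.eval_sub,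
    Polynomial.eval_C, Polynomial.eval_pow, Polynomial.eval_X] at h
  rw [Matrix.eval_charpoly, Polynomial.eval_multiset_prod]
  simpa [Matrix.algebraMap_eq_diagonal, Matrix.scalar_apply, Pi.algebraMap_def,
    Function.comp_def] using h

/-- If `a` normalizes a finite subgroup `H`, then for every `h ∈ H` the elements `a * h` and `a`
have a common positive power. -/
theorem Subgroup.exists_mul_pow_eq_pow {G : Type*} [Group G] (H : Subgroup G) [Finite H]
    {a : G} (ha : ∀ h ∈ H, a * h * a⁻¹ ∈ H) {h : G} (hh : h ∈ H) :
    ∃ k, k ≠ 0 ∧ (a * h) ^ k = a ^ k := by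
  have haN : a ∈ Subgroup.normalizer (H : Set G) :=
    Subgroup.mem_normalizer_fintype ha
  obtain ⟨m, hm, hφ⟩ :=
    (isOfFinOrder_of_finite (H.normalizerMonoidHom ⟨a, haN⟩)).exists_pow_eq_one
  have hcomm (g : G) (hg : g ∈ H) : Commute (a ^ m) g := by
    rw [← map_pow] at hφ
    have h1 := congrArg Subtype.val (DFunLike.congr_fun hφ ⟨g, hg⟩)
    simpa [mul_inv_eq_iff_eq_mul, commute_iff_eq] using h1
  have hmem (k : ℕ) : ∃ g ∈ H, (a * h) ^ k = a ^ k * g := by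
    induction k with
    | zero => exact ⟨1, H.one_mem, by simp⟩
    | succ k ih =>
      obtain ⟨g, hg, hk⟩ := ih
      refine ⟨a⁻¹ * g * a * h, H.mul_mem ?_ hh, by rw [pow_succ, hk, pow_succ]; group⟩
      exact (Subgroup.mem_normalizer_iff''.1 haN g).1 hg
  obtain ⟨g, hg, hk⟩ := hmem m
  refine ⟨m * Nat.card H, mul_ne_zero hm.ne' Nat.card_pos.ne', ?_⟩
  have hone : g ^ Nat.card H = 1 :=
    congrArg Subtype.val (pow_card_eq_one' (x := (⟨g, hg⟩ : H)))
  rw [pow_mul, hk, (hcomm g hg).mul_pow, hone, mul_one, pow_mul]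

/-- The absolute values of the eigenvalues of a matrix are determined by any positive power. -/
theorem Matrix.map_roots_charpoly_eq_of_pow_eq {K ι : Type*} [Field K] [IsAlgClosed K]
    [Fintype ι] [DecidableEq ι] (v : AbsoluteValue K ℝ) {M N : Matrix ι ι K} {k : ℕ}
    (hk : k ≠ 0) (h : M ^ k = N ^ k) :
    M.charpoly.roots.map v = N.charpoly.roots.map v := by
  have key (P : Matrix ι ι K) : P.charpoly.roots.map v =
      (P ^ k).charpoly.roots.map fun x => v x ^ (k : ℝ)⁻¹ := by
    rw [P.roots_charpoly_pow, Multiset.map_map]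
    refine Multiset.map_congr rfl fun x _ => ?_
    simp [Real.pow_rpow_inv_natCast (v.nonneg x) hk]
  rw [key M, key N, h]

/-- If `H` is a finite subgroup of `GL_n(K)` over an algebraically closed field `K` with an
absolute value, and `A` normalizes `H`, then for every `h ∈ H` the multiset of absolute values
of the roots (with multiplicity) of the characteristic polynomial of `A * h` equals the
corresponding multiset for `A`. -/
theorem stmt_0 {K : Type*} [Field K] [IsAlgClosed K]
    (v : AbsoluteValue K ℝ) (n : ℕ) (hn : 1 ≤ n)
    (H : Subgroup (GL (Fin n) K)) [Finite H]
    (A : GL (Fin n) K) (hA : ∀ h ∈ H, A * h * A⁻¹ ∈ H) :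
    ∀ h ∈ H,
      (Matrix.charpoly ((A * h : GL (Fin n) K) : Matrix (Fin n) (Fin n) K)).roots.map ⇑v =
      (Matrix.charpoly ((A : GL (Fin n) K) : Matrix (Fin n) (Fin n) K)).roots.map ⇑v := by
  intro h hh
  obtain ⟨k, hk, hpow⟩ := H.exists_mul_pow_eq_pow hA hh
  exact Matrix.map_roots_charpoly_eq_of_pow_eq v hk (by simpa using congrArg Units.val hpow)
end

section
/- Let K be a field equipped with a valuation v : K× → ℝ, written additively, so that v(xy) = v(x) + v(y) for all nonzero x, y and v(x + y) ≥ min(v(x), v(y)) whenever x, y, x + y are nonzero. Let n ≥ 2 be an integer, let 1 ≤ j ≤ n − 1, let c > 0 be a real number, and let β_1, …, β_n ∈ K× satisfy v(β_1) ≥ v(β_2) ≥ ⋯ ≥ v(β_n). For 1 ≤ k ≤ n let e_k(β) denote the k-th elementary symmetric polynomial evaluated at β_1, …, β_n. Assume v(e_k(β)) ≥ c·k(k−1)/2 for all 1 ≤ k ≤ n, and that equality holds for k = n − j and for k = n. Then: (i) Σ_{i=1}^{j} v(β_i) = c·( n(n−1)/2 − (n−j)(n−j−1)/2 ); (ii)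 v(β_i) ≥ c·(n−j) for all 1 ≤ i ≤ j; (iii) v(β_i) ≤ c·(n−j−1) for all j < i ≤ n. -/
open Finset

section AdditiveValuation

variable {K : Type*} [Field K] {v : K → ℝ}

theorem map_one_of_additive (hmul : ∀ x y : K, x ≠ 0 → y ≠ 0 → v (x * y) = v x + v y) :
    v 1 = 0 := by
  have h := hmul 1 1 one_ne_zero one_ne_zero
  rw [mul_one] at h
  linarith

theorem map_neg_of_additive (hmul : ∀ x y : K, x ≠ 0 → y ≠ 0 → v (x * y) = v x + v y)
    {x : K} (hx : x ≠ 0) : v (-x) = v x := by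
  have hneg : (-1 : K) ≠ 0 := neg_ne_zero.mpr one_ne_zero
  have h := hmul (-1) (-1) hneg hneg
  rw [neg_one_mul, neg_neg, map_one_of_additive hmul] at h
  have h' := hmul (-1) x hneg hx
  rw [neg_one_mul] at h'
  linarith

theorem map_prod_of_additive (hmul : ∀ x y : K, x ≠ 0 → y ≠ 0 → v (x * y) = v x + v y)
    {ι : Type*} {β : ι → K} (hβ : ∀ i, β i ≠ 0) (s : Finset ι) :
    v (∏ i ∈ s, β i) = ∑ i ∈ s, v (β i) := by
  classical
  induction s using Finset.induction_on with
  | empty => simpa using map_one_of_additive hmul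
  | insert a s ha ih =>
    rw [prod_insert ha, sum_insert ha, hmul _ _ (hβ a) (prod_ne_zero_iff.mpr fun i _ => hβ i), ih]

/-- The elements whose valuation lies in an upper set, together with zero, are closed under
finite sums. -/
theorem sum_eq_zero_or_map_mem_of_isUpperSet
    (hadd : ∀ x y : K, x ≠ 0 → y ≠ 0 → x + y ≠ 0 → min (v x) (v y) ≤ v (x + y))
    {U : Set ℝ} (hU : IsUpperSet U) {ι : Type*} (s : Finset ι) (f : ι → K)
    (hf : ∀ i ∈ s, v (f i) ∈ U) :
    ∑ i ∈ s, f i = 0 ∨ v (∑ i ∈ s, f i) ∈ U := by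
  refine sum_induction f (fun x => x = 0 ∨ v x ∈ U) ?_ (Or.inl rfl) fun i hi => Or.inr (hf i hi)
  intro x y hx hy
  by_cases hx0 : x = 0
  · simpa [hx0] using hy
  by_cases hy0 : y = 0
  · simpa [hy0] using hx
  by_cases hxy : x + y = 0
  · exact Or.inl hxy
  refine Or.inr (hU (hadd x y hx0 hy0 hxy) ?_)
  rcases min_choice (v x) (v y) with h | h <;> rw [h]
  · exact hx.resolve_left hx0
  · exact hy.resolve_left hy0

/-- A summand of strictly smallest valuation dominates the sum. -/
theorem add_ne_zero_and_map_add_le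
    (hmul : ∀ x y : K, x ≠ 0 → y ≠ 0 → v (x * y) = v x + v y)
    (hadd : ∀ x y : K, x ≠ 0 → y ≠ 0 → x + y ≠ 0 → min (v x) (v y) ≤ v (x + y))
    {x y : K} (hx : x ≠ 0) (hy : y = 0 ∨ v x < v y) :
    x + y ≠ 0 ∧ v (x + y) ≤ v x := by
  by_cases hy0 : y = 0
  · simp [hy0, hx]
  have hlt := hy.resolve_left hy0
  have hne : x + y ≠ 0 := by
    intro h
    rw [eq_neg_of_add_eq_zero_left h, map_neg_of_additive hmul hy0] at hlt
    exact lt_irrefl _ hlt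
  refine ⟨hne, ?_⟩
  have h := hadd (x + y) (-y) hne (neg_ne_zero.mpr hy0) (by simpa using hx)
  rw [add_neg_cancel_right, map_neg_of_additive hmul hy0] at h
  rcases min_le_iff.mp h with h | h
  · exact h
  · exact absurd h (not_le.mpr hlt)

end AdditiveValuation

/-- If `a ≤ L` on `T` and `M ≤ a` off `T`, replacing `T` by a set `t` of the same size raises the
sum of `a` by at least `M - L` per exchanged element. -/
theorem sum_add_card_sdiff_mul_le {ι : Type*} [DecidableEq ι] {a : ι → ℝ} {L M : ℝ}
    {T t : Finset ι} (hT : ∀ i ∈ T, a i ≤ L) (hT' : ∀ i ∉ T, M ≤ a i) (hcard : #t = #T) :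
    ∑ i ∈ T, a i + #(t \ T) * (M - L) ≤ ∑ i ∈ t, a i := by
  have h1 := sum_sdiff_sub_sum_sdiff (s₁ := t) (s₂ := T) (f := a)
  have h2 : #(t \ T) * M ≤ ∑ i ∈ t \ T, a i := by
    simpa using card_nsmul_le_sum (t \ T) a M fun i hi => hT' i (mem_sdiff.mp hi).2
  have h3 : ∑ i ∈ T \ t, a i ≤ #(t \ T) * L := by
    rw [card_sdiff_comm hcard]
    simpa using sum_le_card_nsmul (T \ t) a L fun i hi => hT i (mem_sdiff.mp hi).1
  linarith

/-- The last `k` indices of `Fin n`. -/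
def lastIndices (n k : ℕ) : Finset (Fin n) := univ.filter fun i => n ≤ (i : ℕ) + k

theorem mem_lastIndices {n k : ℕ} {i : Fin n} : i ∈ lastIndices n k ↔ n ≤ (i : ℕ) + k := by
  simp [lastIndices]

theorem lastIndices_zero (n : ℕ) : lastIndices n 0 = ∅ := by
  ext i
  simp [mem_lastIndices]

theorem lastIndices_self (n : ℕ) : lastIndices n n = univ := by
  ext i
  simp [mem_lastIndices]

theorem sum_lastIndices_succ {M : Type*} [AddCommMonoid M] {n k : ℕ} (hk : k < n)
    (a : Fin n → M) :
    ∑ i ∈ lastIndices n (k + 1), a i =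
      a ⟨n - k - 1, by omega⟩ + ∑ i ∈ lastIndices n k, a i := by
  have h : lastIndices n (k + 1) = insert ⟨n - k - 1, by omega⟩ (lastIndices n k) := by
    ext i
    simp only [mem_lastIndices, mem_insert, Fin.ext_iff]
    omega
  rw [h, sum_insert]
  simp only [mem_lastIndices]
  omega

theorem card_lastIndices {n k : ℕ} (hk : k ≤ n) : #(lastIndices n k) = k := by
  induction k with
  | zero => simp [lastIndices_zero]
  | succ k ih =>
    rw [card_eq_sum_ones, sum_lastIndices_succ hk, ← card_eq_sum_ones, ih (by omega), add_comm]

section NewtonPolygon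

variable {K : Type*} [Field K] {v : K → ℝ} {n : ℕ} {β : Fin n → K}

theorem sum_lastIndices_le_map_esymm
    (hmul : ∀ x y : K, x ≠ 0 → y ≠ 0 → v (x * y) = v x + v y)
    (hadd : ∀ x y : K, x ≠ 0 → y ≠ 0 → x + y ≠ 0 → min (v x) (v y) ≤ v (x + y))
    (hβ : ∀ i, β i ≠ 0) (hmono : ∀ i i' : Fin n, i ≤ i' → v (β i') ≤ v (β i))
    {k : ℕ} (hk0 : 0 < k) (hkn : k ≤ n)
    (hne : ∑ t ∈ univ.powersetCard k, ∏ i ∈ t, β i ≠ 0) :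
    ∑ i ∈ lastIndices n k, v (β i) ≤ v (∑ t ∈ univ.powersetCard k, ∏ i ∈ t, β i) := by
  refine (sum_eq_zero_or_map_mem_of_isUpperSet hadd
    (isUpperSet_Ici (∑ i ∈ lastIndices n k, v (β i))) _ _ fun t ht => ?_).resolve_left hne
  rw [Set.mem_Ici, map_prod_of_additive hmul hβ]
  have h := sum_add_card_sdiff_mul_le (a := fun i => v (β i)) (T := lastIndices n k) (t := t)
    (L := v (β ⟨n - k, by omega⟩)) (M := v (β ⟨n - k, by omega⟩))
    (fun i hi => hmono _ _ (by rw [mem_lastIndices] at hi; rw [Fin.le_def]; simp only; omega))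
    (fun i hi => hmono _ _ (by rw [mem_lastIndices] at hi; rw [Fin.le_def]; simp only; omega))
    (by rw [card_lastIndices hkn, (mem_powersetCard.mp ht).2])
  simpa using h

/-- At a break of the Newton polygon, the elementary symmetric function is nonzero and its
valuation lies on the polygon. -/
theorem esymm_ne_zero_and_map_esymm_le
    (hmul : ∀ x y : K, x ≠ 0 → y ≠ 0 → v (x * y) = v x + v y)
    (hadd : ∀ x y : K, x ≠ 0 → y ≠ 0 → x + y ≠ 0 → min (v x) (v y) ≤ v (x + y))
    (hβ : ∀ i, β i ≠ 0) (hmono : ∀ i i' : Fin n, i ≤ i' → v (β i') ≤ v (β i))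
    {k : ℕ} (hk0 : 0 < k) (hkn : k < n)
    (hbreak : v (β ⟨n - k, by omega⟩) < v (β ⟨n - k - 1, by omega⟩)) :
    ∑ t ∈ univ.powersetCard k, ∏ i ∈ t, β i ≠ 0 ∧
      v (∑ t ∈ univ.powersetCard k, ∏ i ∈ t, β i) ≤ ∑ i ∈ lastIndices n k, v (β i) := by
  have hmem : lastIndices n k ∈ univ.powersetCard k :=
    mem_powersetCard.mpr ⟨subset_univ _, card_lastIndices hkn.le⟩
  rw [← add_sum_erase _ _ hmem, ← map_prod_of_additive hmul hβ]
  refine add_ne_zero_and_map_add_le hmul hadd (prod_ne_zero_iff.mpr fun i _ => hβ i) ?_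
  refine sum_eq_zero_or_map_mem_of_isUpperSet hadd (isUpperSet_Ioi _) _ _ fun t ht => ?_
  obtain ⟨hne, ht⟩ := mem_erase.mp ht
  have hcard : #t = #(lastIndices n k) := by
    rw [card_lastIndices hkn.le, (mem_powersetCard.mp ht).2]
  rw [Set.mem_Ioi, map_prod_of_additive hmul hβ, map_prod_of_additive hmul hβ]
  have h := sum_add_card_sdiff_mul_le (a := fun i => v (β i)) (T := lastIndices n k) (t := t)
    (L := v (β ⟨n - k, by omega⟩)) (M := v (β ⟨n - k - 1, by omega⟩))
    (fun i hi => hmono _ _ (by rw [mem_lastIndices] at hi; rw [Fin.le_def]; simp only; omega))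
    (fun i hi => hmono _ _ (by rw [mem_lastIndices] at hi; rw [Fin.le_def]; simp only; omega))
    hcard
  have hpos : 0 < #(t \ lastIndices n k) := by
    rw [card_pos, sdiff_nonempty]
    exact fun hsub => hne (eq_of_subset_of_card_le hsub hcard.ge)
  have hprod : (0 : ℝ) < #(t \ lastIndices n k) *
      (v (β ⟨n - k - 1, by omega⟩) - v (β ⟨n - k, by omega⟩)) :=
    mul_pos (by exact_mod_cast hpos) (sub_pos.mpr hbreak)
  linarith

/-- If the valuations of the elementary symmetric functions lie above the parabola
`c * k * (k - 1) / 2`, with equality at `k = n`, then so does the whole Newton polygon. -/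
theorem parabola_le_sum_lastIndices
    (hmul : ∀ x y : K, x ≠ 0 → y ≠ 0 → v (x * y) = v x + v y)
    (hadd : ∀ x y : K, x ≠ 0 → y ≠ 0 → x + y ≠ 0 → min (v x) (v y) ≤ v (x + y))
    (hβ : ∀ i, β i ≠ 0) (hmono : ∀ i i' : Fin n, i ≤ i' → v (β i') ≤ v (β i))
    {c : ℝ} (hc : 0 < c)
    (hge : ∀ k, 0 < k → k < n → ∑ t ∈ univ.powersetCard k, ∏ i ∈ t, β i ≠ 0 →
      c * ((k : ℝ) * ((k : ℝ) - 1)) / 2 ≤ v (∑ t ∈ univ.powersetCard k, ∏ i ∈ t, β i))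
    (heqn : ∑ i, v (β i) = c * ((n : ℝ) * ((n : ℝ) - 1)) / 2) {k : ℕ} (hk : k ≤ n) :
    c * ((k : ℝ) * ((k : ℝ) - 1)) / 2 ≤ ∑ i ∈ lastIndices n k, v (β i) := by
  obtain ⟨l, hl, hmin⟩ := exists_min_image (range (n + 1))
    (fun k : ℕ => ∑ i ∈ lastIndices n k, v (β i) - c * ((k : ℝ) * ((k : ℝ) - 1)) / 2)
    ⟨0, by simp⟩
  have hln : l ≤ n := Nat.lt_succ_iff.mp (mem_range.mp hl)
  suffices h : c * ((l : ℝ) * ((l : ℝ) - 1)) / 2 ≤ ∑ i ∈ lastIndices n l, v (β i) by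
    have := hmin k (mem_range.mpr (Nat.lt_succ_of_le hk))
    linarith
  rcases Nat.eq_zero_or_pos l with rfl | hl0
  · simp [lastIndices_zero]
  rcases hln.eq_or_lt with rfl | hln
  · rw [lastIndices_self, heqn]
  have hbreak : v (β ⟨n - l, by omega⟩) < v (β ⟨n - l - 1, by omega⟩) := by
    have h1 := hmin (l + 1) (mem_range.mpr (by omega))
    have h2 := hmin (l - 1) (mem_range.mpr (by omega))
    obtain ⟨l, rfl⟩ := Nat.exists_eq_add_of_lt hl0
    simp only [zero_add, Nat.add_sub_cancel] at h1 h2 ⊢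
    rw [sum_lastIndices_succ (k := l + 1) (by omega)] at h1
    rw [sum_lastIndices_succ (by omega)] at h2
    simp only [Nat.sub_sub] at h1 h2 ⊢
    push_cast at h1 h2
    linarith
  obtain ⟨hne, hle⟩ := esymm_ne_zero_and_map_esymm_le hmul hadd hβ hmono hl0 hln hbreak
  exact (hge l hl0 hln hne).trans hle

end NewtonPolygon


/-- Newton polygon vertex lemma (underlying Prop. 6.3.7, equations (6.3.10)-(6.3.12)):
if `v` is an additive valuation on `K`, `β_1, …, β_n` are nonzero with non-increasing
valuations, the elementary symmetric functions `e_k(β)` satisfy `v(e_k) ≥ c·k(k-1)/2`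
with equality for `k = n - j` and `k = n`, then the sum of the first `j` valuations equals
`c·(n(n-1)/2 - (n-j)(n-j-1)/2)`, with the bounds `v(β_i) ≥ c(n-j)` for `i ≤ j` and
`v(β_i) ≤ c(n-j-1)` for `i > j`. -/
theorem stmt_1 {K : Type*} [Field K] (v : K → ℝ)
    (hmul : ∀ x y : K, x ≠ 0 → y ≠ 0 → v (x * y) = v x + v y)
    (hadd : ∀ x y : K, x ≠ 0 → y ≠ 0 → x + y ≠ 0 → min (v x) (v y) ≤ v (x + y))
    (n : ℕ) (hn : 2 ≤ n) (j : ℕ) (hj1 : 1 ≤ j) (hjn : j ≤ n - 1)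
    (c : ℝ) (hc : 0 < c)
    (β : Fin n → K) (hβ : ∀ i, β i ≠ 0)
    (hmono : ∀ i i' : Fin n, i ≤ i' → v (β i') ≤ v (β i))
    (e : ℕ → K)
    (he : ∀ k, e k = ∑ t ∈ Finset.univ.powersetCard k, ∏ i ∈ t, β i)
    (hge : ∀ k, 1 ≤ k → k ≤ n → e k ≠ 0 →
      c * ((k : ℝ) * ((k : ℝ) - 1)) / 2 ≤ v (e k))
    (hnj : e (n - j) ≠ 0)
    (heqj : v (e (n - j)) = c * (((n - j : ℕ) : ℝ) * (((n - j : ℕ) : ℝ) - 1)) / 2)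
    (heqn : v (e n) = c * ((n : ℝ) * ((n : ℝ) - 1)) / 2) :
    (∑ i ∈ Finset.univ.filter (fun i : Fin n => (i : ℕ) < j), v (β i)
        = c * ((n : ℝ) * ((n : ℝ) - 1) / 2
            - ((n - j : ℕ) : ℝ) * (((n - j : ℕ) : ℝ) - 1) / 2)) ∧
    (∀ i : Fin n, (i : ℕ) < j → c * ((n : ℝ) - (j : ℝ)) ≤ v (β i)) ∧
    (∀ i : Fin n, j ≤ (i : ℕ) → v (β i) ≤ c * ((n : ℝ) - (j : ℝ) - 1)) := by
  obtain rfl : e = fun k => ∑ t ∈ univ.powersetCard k, ∏ i ∈ t, β i := funext he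
  have hsum : ∑ i, v (β i) = c * ((n : ℝ) * ((n : ℝ) - 1)) / 2 := by
    rw [← heqn, ← map_prod_of_additive hmul hβ]
    have h : (univ : Finset (Fin n)).powersetCard n = {univ} := by
      simpa using powersetCard_self (univ : Finset (Fin n))
    simp only [h, sum_singleton]
  have hlow : ∀ {k : ℕ}, k ≤ n →
      c * ((k : ℝ) * ((k : ℝ) - 1)) / 2 ≤ ∑ i ∈ lastIndices n k, v (β i) :=
    parabola_le_sum_lastIndices hmul hadd hβ hmono hc
      (fun k hk0 hkn => hge k hk0 hkn.le) hsum
  obtain ⟨m, rfl⟩ : ∃ m, n = m + 1 + j := ⟨n - j - 1, by omega⟩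
  rw [Nat.add_sub_cancel] at hnj heqj ⊢
  have hvertex : ∑ i ∈ lastIndices (m + 1 + j) (m + 1), v (β i) =
      c * (((m + 1 : ℕ) : ℝ) * (((m + 1 : ℕ) : ℝ) - 1)) / 2 :=
    le_antisymm (heqj ▸ sum_lastIndices_le_map_esymm hmul hadd hβ hmono (by omega) (by omega) hnj)
      (hlow (by omega))
  refine ⟨?_, fun i hi => ?_, fun i hi => ?_⟩
  · have hsplit := sum_filter_add_sum_filter_not univ
      (fun i : Fin (m + 1 + j) => (i : ℕ) < j) (fun i => v (β i))
    have hlast : univ.filter (fun i : Fin (m + 1 + j) => ¬ (i : ℕ) < j) =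
        lastIndices (m + 1 + j) (m + 1) := by
      ext i
      simp only [mem_filter, mem_univ, true_and, mem_lastIndices]
      omega
    rw [hlast, hvertex, hsum] at hsplit
    linarith
  · have h := hlow (k := m + 1 + 1) (by omega)
    rw [sum_lastIndices_succ (by omega), hvertex] at h
    have hi' := hmono i ⟨m + 1 + j - (m + 1) - 1, by omega⟩
      (by rw [Fin.le_def]; simp only; omega)
    push_cast at h ⊢
    linarith
  · have h := hlow (k := m) (by omega)
    rw [sum_lastIndices_succ (by omega)] at hvertex
    have hi' := hmono ⟨m + 1 + j - m - 1, by omega⟩ i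
      (by rw [Fin.le_def]; simp only; omega)
    push_cast at hvertex ⊢
    linarith
end

section
/- Let q ≥ 2 and N ≥ 1 be integers and let s be an integer. Then the N residue classes of s, sq, sq², …, sq^{N−1} modulo q^N − 1 are pairwise distinct if and only if for every divisor ℓ of N with ℓ < N, the integer (q^N − 1)/(q^ℓ − 1) does not divide s. Moreover, (q^N − 1)/(q^ℓ − 1) ≥ q + 1 for every divisor ℓ of N with ℓ < N; consequently, every integer s with 1 ≤ s ≤ q − 1 satisfies the pairwise-distinctness condition above. -/
theorem Int.gcd_pow_sub_one_pow_sub_one {q : ℕ} (hq : 1 ≤ q) (a b : ℕ) :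
    (Int.gcd ((q : ℤ) ^ a - 1) ((q : ℤ) ^ b - 1) : ℤ) = (q : ℤ) ^ Nat.gcd a b - 1 := by
  have cast_sub (n : ℕ) : (q : ℤ) ^ n - 1 = ((q ^ n - 1 : ℕ) : ℤ) := by
    rw [Nat.cast_sub (Nat.one_le_pow _ _ hq)]
    simp
  rw [cast_sub, cast_sub, cast_sub, Int.gcd_natCast_natCast, Nat.pow_sub_one_gcd_pow_sub_one]

theorem Int.dvd_mul_gcd {m s a b : ℤ} (ha : m ∣ s * a) (hb : m ∣ s * b) :
    m ∣ s * Int.gcd a b := by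
  rw [Int.gcd_eq_gcd_ab, mul_add, ← mul_assoc, ← mul_assoc]
  exact dvd_add (ha.mul_right _) (hb.mul_right _)

theorem Int.pow_sub_one_pos {q ℓ : ℕ} (hq : 2 ≤ q) (hℓ : ℓ ≠ 0) : 0 < (q : ℤ) ^ ℓ - 1 :=
  sub_pos.2 (one_lt_pow₀ (by exact_mod_cast hq) hℓ)

theorem Int.pow_sub_one_dvd_pow_sub_one (q : ℤ) {ℓ N : ℕ} (h : ℓ ∣ N) :
    q ^ ℓ - 1 ∣ q ^ N - 1 := by
  obtain ⟨k, rfl⟩ := h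
  simpa [pow_mul] using sub_dvd_pow_sub_pow (q ^ ℓ) 1 k

theorem Int.pow_sub_one_ediv_dvd_iff {q ℓ N : ℕ} (hq : 2 ≤ q) (hℓ : ℓ ≠ 0) (h : ℓ ∣ N) (s : ℤ) :
    ((q : ℤ) ^ N - 1) / ((q : ℤ) ^ ℓ - 1) ∣ s ↔ (q : ℤ) ^ N - 1 ∣ s * ((q : ℤ) ^ ℓ - 1) := by
  have hpos := Int.pow_sub_one_pos hq hℓ
  conv_rhs => rw [← Int.ediv_mul_cancel (Int.pow_sub_one_dvd_pow_sub_one (q : ℤ) h)]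
  exact (mul_dvd_mul_iff_right hpos.ne').symm

theorem Int.add_one_le_pow_sub_one_ediv {q ℓ N : ℕ} (hq : 2 ≤ q) (h : ℓ ∣ N) (hlt : ℓ < N) :
    (q : ℤ) + 1 ≤ ((q : ℤ) ^ N - 1) / ((q : ℤ) ^ ℓ - 1) := by
  have hℓ : ℓ ≠ 0 := by
    rintro rfl
    exact hlt.ne' (zero_dvd_iff.1 h)
  have hpos := Int.pow_sub_one_pos hq hℓ
  have hq1 : (1 : ℤ) ≤ q := by exact_mod_cast (by omega : 1 ≤ q)
  have h2 : ℓ * 2 ≤ N := by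
    obtain ⟨k, rfl⟩ := h
    exact Nat.mul_le_mul_left _ (by by_contra!; interval_cases k <;> omega)
  rw [Int.le_ediv_iff_mul_le hpos]
  calc ((q : ℤ) + 1) * ((q : ℤ) ^ ℓ - 1)
      ≤ ((q : ℤ) ^ ℓ + 1) * ((q : ℤ) ^ ℓ - 1) := by
        gcongr
        exact le_self_pow₀ hq1 hℓ
    _ = (q : ℤ) ^ (ℓ * 2) - 1 := by rw [pow_mul]; ring
    _ ≤ (q : ℤ) ^ N - 1 := by gcongr

theorem Int.exists_dvd_of_mul_pow_modEq {q N : ℕ} (hq : 2 ≤ q) {s : ℤ} {i j : ℕ}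
    (hij : i < j) (hj : j < N)
    (h : Int.ModEq ((q : ℤ) ^ N - 1) (s * (q : ℤ) ^ i) (s * (q : ℤ) ^ j)) :
    ∃ ℓ : ℕ, ℓ ∣ N ∧ ℓ < N ∧ ((q : ℤ) ^ N - 1) / ((q : ℤ) ^ ℓ - 1) ∣ s := by
  obtain ⟨d, rfl⟩ := Nat.exists_eq_add_of_lt hij
  set e := d + 1 with he
  have hg : Nat.gcd e N ≤ e := Nat.gcd_le_left _ (by omega)
  have hg0 : Nat.gcd e N ≠ 0 := (Nat.gcd_pos_of_pos_left _ (by omega)).ne'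
  refine ⟨Nat.gcd e N, Nat.gcd_dvd_right _ _, by omega, ?_⟩
  rw [Int.pow_sub_one_ediv_dvd_iff hq hg0 (Nat.gcd_dvd_right _ _),
    ← Int.gcd_pow_sub_one_pow_sub_one (by omega)]
  refine Int.dvd_mul_gcd ?_ (dvd_mul_left _ _)
  have hcop : IsCoprime ((q : ℤ) ^ N - 1) ((q : ℤ) ^ i) := by
    refine IsCoprime.pow_right ⟨-1, (q : ℤ) ^ (N - 1), ?_⟩
    rw [← pow_succ, Nat.sub_add_cancel (by omega)]
    ring
  refine hcop.dvd_of_dvd_mul_left ?_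
  have factor : (q : ℤ) ^ i * (s * ((q : ℤ) ^ e - 1)) =
      s * (q : ℤ) ^ (i + d + 1) - s * (q : ℤ) ^ i := by
    rw [he]
    ring
  rw [factor]
  exact h.dvd

theorem Int.mul_pow_modEq_injective_iff {q N : ℕ} (hq : 2 ≤ q) (hN : 1 ≤ N) (s : ℤ) :
    (∀ i j : ℕ, i < N → j < N →
        Int.ModEq ((q : ℤ) ^ N - 1) (s * (q : ℤ) ^ i) (s * (q : ℤ) ^ j) → i = j) ↔
      (∀ ℓ : ℕ, ℓ ∣ N → ℓ < N → ¬ (((q : ℤ) ^ N - 1) / ((q : ℤ) ^ ℓ - 1) ∣ s)) := by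
  constructor
  · intro hinj ℓ hdvd hlt hs
    have hℓ : ℓ ≠ 0 := (Nat.pos_of_dvd_of_pos hdvd hN).ne'
    rw [Int.pow_sub_one_ediv_dvd_iff hq hℓ hdvd] at hs
    refine hℓ (hinj 0 ℓ hN hlt ?_).symm
    rw [Int.modEq_iff_dvd]
    simpa [mul_sub] using hs
  · intro hs i j hi hj h
    rcases lt_trichotomy i j with hij | hij | hij
    · obtain ⟨ℓ, hdvd, hlt, hℓ⟩ := Int.exists_dvd_of_mul_pow_modEq hq hij hj h
      exact absurd hℓ (hs ℓ hdvd hlt)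
    · exact hij
    · obtain ⟨ℓ, hdvd, hlt, hℓ⟩ := Int.exists_dvd_of_mul_pow_modEq hq hij hi h.symm
      exact absurd hℓ (hs ℓ hdvd hlt)

/-- Condition (6.6.5) and the inequality from Step 7 of the proof of Theorem 6.6.1:
the residue classes of `s, sq, …, sq^{N-1}` modulo `q^N - 1` are pairwise distinct iff
`(q^N - 1)/(q^ℓ - 1)` does not divide `s` for every proper divisor `ℓ` of `N`; moreover
`(q^N - 1)/(q^ℓ - 1) ≥ q + 1` for every such `ℓ`, so every `s` with `1 ≤ s ≤ q - 1`
satisfies the distinctness condition. -/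
theorem stmt_5 (q N : ℕ) (hq : 2 ≤ q) (hN : 1 ≤ N) (s : ℤ) :
    ((∀ i j : ℕ, i < N → j < N →
        Int.ModEq ((q : ℤ) ^ N - 1) (s * (q : ℤ) ^ i) (s * (q : ℤ) ^ j) → i = j) ↔
      (∀ ℓ : ℕ, ℓ ∣ N → ℓ < N → ¬ (((q : ℤ) ^ N - 1) / ((q : ℤ) ^ ℓ - 1) ∣ s))) ∧
    (∀ ℓ : ℕ, ℓ ∣ N → ℓ < N →
      (q : ℤ) + 1 ≤ ((q : ℤ) ^ N - 1) / ((q : ℤ) ^ ℓ - 1)) ∧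
    (∀ t : ℤ, 1 ≤ t → t ≤ (q : ℤ) - 1 →
      ∀ i j : ℕ, i < N → j < N →
        Int.ModEq ((q : ℤ) ^ N - 1) (t * (q : ℤ) ^ i) (t * (q : ℤ) ^ j) → i = j) := by
  refine ⟨Int.mul_pow_modEq_injective_iff hq hN s,
    fun ℓ => Int.add_one_le_pow_sub_one_ediv hq, fun t ht1 htq => ?_⟩
  refine (Int.mul_pow_modEq_injective_iff hq hN t).2 fun ℓ hdvd hlt hdiv => ?_
  have h1 := Int.add_one_le_pow_sub_one_ediv hq hdvd hlt
  have h2 := Int.le_of_dvd (by omega) hdiv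
  linarith
end
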